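/- arXiv:2309.07342 — 2 statements merged into one kernel-verified Lean document; each statement's English description precedes it below -/
import Mathlib

section
/- Existence and uniqueness of scattering states for the model system, single-mode version (Theorem 3.7 of the paper): for every λ ≥ 0 and every triple (c₀, O, h) ∈ ℝ³, there exists exactly one pair (a, c), with a twice continuously differentiable on (0,∞) and c continuous on [0,∞) and differentiable on (0,∞), that solves the mode-λ model system on (0,∞) and has asymptotic data (c₀, O, h) at τ = 0. -/
open Set Filter

/-- The pair `(a, c)` solves the mode-`lam` model system on `I ⊆ (0,∞)`:
`a` is twice differentiable and `c` is differentiable on `I`, and for all `τ ∈ I`,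
(E) `a'' + τ⁻¹·a' + 4q'·a + 4λ²·(τ²+1)⁻²·a = f₁·τ·a' + f₂·τ²·a + f₃·c` and
(C) `c' = 2τ·a`. -/
def SolvesModelSystem (q' : ℝ) (f₁ f₂ f₃ : ℝ → ℝ) (lam : ℝ)
    (a c : ℝ → ℝ) (I : Set ℝ) : Prop :=
  ∀ τ ∈ I,
    DifferentiableAt ℝ a τ ∧ DifferentiableAt ℝ (deriv a) τ ∧ DifferentiableAt ℝ c τ ∧
    (deriv (deriv a) τ + τ⁻¹ * deriv a τ + 4 * q' * a τ
        + 4 * lam ^ 2 * ((τ ^ 2 + 1) ^ 2)⁻¹ * a τ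
      = f₁ τ * τ * deriv a τ + f₂ τ * τ ^ 2 * a τ + f₃ τ * c τ) ∧
    deriv c τ = 2 * τ * a τ

/-- The pair `(a, c)` (solving the model system on `(0,∞)`, with `c` extended
continuously to `[0,∞)`) has asymptotic data `(c₀, O, h)` at `τ = 0`. -/
def HasAsymptoticData (a c : ℝ → ℝ) (c₀ O h : ℝ) : Prop :=
  ContinuousOn c (Ici 0) ∧ c 0 = c₀ ∧
  ∃ K : ℝ, 0 ≤ K ∧ ∀ τ ∈ Ioc (0:ℝ) 1,
    |a τ - O * Real.log τ - h| ≤ K * τ ^ 2 * (1 + Real.log τ ^ 2) ∧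
    |deriv a τ - O / τ| ≤ K * τ * (1 + Real.log τ ^ 2)

open scoped NNReal Topology

section LinearODE

variable {E : Type*} [NormedAddCommGroup E] [NormedSpace ℝ E]

/-- A solution of a linear ODE on `(0, T)` that tends to zero at `0` vanishes. -/
theorem eq_zero_of_hasDerivAt_linear {A : ℝ → E →L[ℝ] E} {T : ℝ}
    (hA : ContinuousOn A (Icc 0 T)) {D : ℝ → E}
    (hD : ∀ t ∈ Ioo 0 T, HasDerivAt D (A t (D t)) t)
    (h0 : Tendsto D (𝓝[>] 0) (𝓝 0)) : ∀ t ∈ Ioo 0 T, D t = 0 := by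
  intro t ht
  obtain ⟨M, hM⟩ := isCompact_Icc.exists_bound_of_continuousOn hA
  have hle : ∀ s ∈ Ioo 0 t, ‖D t‖ ≤ ‖D s‖ * Real.exp (M * (t - s)) := by
    intro s hs
    have hsub : ∀ x ∈ Icc s t, x ∈ Ioo 0 T := fun x hx =>
      ⟨hs.1.trans_le hx.1, hx.2.trans_lt ht.2⟩
    have := norm_le_gronwallBound_of_norm_deriv_right_le (f := D) (f' := fun x => A x (D x))
      (δ := ‖D s‖) (K := M) (ε := 0) (a := s) (b := t)
      (fun x hx => (hD x (hsub x hx)).continuousAt.continuousWithinAt)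
      (fun x hx => (hD x (hsub x (Ico_subset_Icc_self hx))).hasDerivWithinAt) le_rfl
      (fun x hx => by
        have hx' := hsub x (Ico_subset_Icc_self hx)
        rw [add_zero]
        exact (A x).le_of_opNorm_le (hM x (Ioo_subset_Icc_self hx')) _) t ⟨hs.2.le, le_rfl⟩
    rwa [gronwallBound_ε0] at this
  have hlim : Tendsto (fun s => ‖D s‖ * Real.exp (M * (t - s))) (𝓝[>] 0)
      (𝓝 (‖(0 : E)‖ * Real.exp (M * (t - 0)))) :=
    h0.norm.mul ((by fun_prop : Continuous fun s => Real.exp (M * (t - s))).continuousAt.mono_left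
      nhdsWithin_le_nhds)
  have hfin := ge_of_tendsto hlim (by
    filter_upwards [Ioo_mem_nhdsGT ht.1] with s hs using hle s hs)
  simpa using hfin

/-- Two solutions of a linear ODE on `(0, T)` with the same limit at `0` coincide. -/
theorem eq_of_hasDerivAt_linear {A : ℝ → E →L[ℝ] E} {T : ℝ}
    (hA : ContinuousOn A (Icc 0 T)) {y z : ℝ → E} {y₀ : E}
    (hy : ∀ t ∈ Ioo 0 T, HasDerivAt y (A t (y t)) t)
    (hz : ∀ t ∈ Ioo 0 T, HasDerivAt z (A t (z t)) t)
    (hy₀ : Tendsto y (𝓝[>] 0) (𝓝 y₀)) (hz₀ : Tendsto z (𝓝[>] 0) (𝓝 y₀)) :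
    ∀ t ∈ Ioo 0 T, y t = z t := by
  intro t ht
  have := eq_zero_of_hasDerivAt_linear hA (D := y - z)
    (fun s hs => by simpa using (hy s hs).sub (hz s hs))
    (by simpa only [sub_self] using! hy₀.sub hz₀) t ht
  exact sub_eq_zero.mp this

variable {ι : Type*} [Fintype ι]

/-- Coordinatewise truncation to `[-R, R]`. -/
def coordClip (R : ℝ) (x : ι → ℝ) : ι → ℝ := fun i => max (-R) (min R (x i))

theorem lipschitzWith_coordClip (R : ℝ) : LipschitzWith 1 (coordClip R : (ι → ℝ) → ι → ℝ) := by
  refine LipschitzWith.of_dist_le_mul fun x y => ?_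
  rw [NNReal.coe_one, one_mul, dist_pi_le_iff dist_nonneg]
  intro i
  have := ((LipschitzWith.id (α := ℝ)).const_min R).const_max (-R)
  have h := this.dist_le_mul (x i) (y i)
  rw [NNReal.coe_one, one_mul] at h
  exact h.trans (dist_le_pi_dist x y i)

theorem norm_coordClip_le {R : ℝ} (hR : 0 ≤ R) (x : ι → ℝ) : ‖coordClip R x‖ ≤ R := by
  rw [pi_norm_le_iff_of_nonneg hR]
  intro i
  rw [Real.norm_eq_abs, abs_le]
  exact ⟨le_max_left _ _, max_le (by linarith) (min_le_left _ _)⟩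

theorem coordClip_eq_self {R : ℝ} {x : ι → ℝ} (hx : ‖x‖ ≤ R) : coordClip R x = x := by
  funext i
  have := abs_le.mp ((norm_le_pi_norm x i).trans hx)
  simp [coordClip, this.1, this.2]

theorem norm_coordClip_le_norm {R : ℝ} (hR : 0 ≤ R) (x : ι → ℝ) : ‖coordClip R x‖ ≤ ‖x‖ := by
  have := (lipschitzWith_coordClip R).dist_le_mul x 0
  rwa [coordClip_eq_self (x := (0 : ι → ℝ)) (by simpa using hR), dist_zero_right, dist_zero_right,
    NNReal.coe_one, one_mul] at this

theorem exists_hasDerivWithinAt_linear_Icc {A : ℝ → (ι → ℝ) →L[ℝ] (ι → ℝ)} {T : ℝ} (hT : 0 ≤ T)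
    (hA : ContinuousOn A (Icc 0 T)) (y₀ : ι → ℝ) :
    ∃ y : ℝ → ι → ℝ, y 0 = y₀ ∧
      ∀ t ∈ Icc 0 T, HasDerivWithinAt y (A t (y t)) (Icc 0 T) t := by
  obtain ⟨M', hM'⟩ := isCompact_Icc.exists_bound_of_continuousOn hA
  set M : ℝ≥0 := M'.toNNReal
  have hM : ∀ t ∈ Icc 0 T, ‖A t‖ ≤ M := fun t ht => (hM' t ht).trans (Real.le_coe_toNNReal _)
  set R : ℝ≥0 := NNReal.mk (‖y₀‖ * Real.exp (M * T)) (by positivity) with hRdef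
  have hpl : IsPicardLindelof (fun t x => A t (coordClip R x)) (tmin := 0) (tmax := T)
      ⟨0, le_rfl, hT⟩ y₀ (M * R * T.toNNReal) 0 (M * R) M := by
    refine ⟨fun t ht => ?_, fun x _ => ?_, fun t ht x _ => ?_, ?_⟩
    · have h1 : LipschitzWith M (A t) := (A t).lipschitz.weaken (hM t ht)
      have h2 := (h1.comp (lipschitzWith_coordClip (R : ℝ))).lipschitzOnWith
        (s := Metric.closedBall y₀ (M * R * T.toNNReal : ℝ≥0))
      rwa [mul_one] at h2
    · exact hA.clm_apply continuousOn_const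
    · push_cast
      exact ((A t).le_of_opNorm_le (hM t ht) _).trans
        (mul_le_mul_of_nonneg_left (norm_coordClip_le R.2 x) M.2)
    · simp [hT]
  obtain ⟨y, hy0, hy⟩ := hpl.exists_eq_forall_mem_Icc_hasDerivWithinAt₀
  refine ⟨y, hy0, fun t ht => ?_⟩
  have hbound : ∀ t ∈ Icc 0 T, ‖y t‖ ≤ R := by
    intro t ht
    have h := norm_le_gronwallBound_of_norm_deriv_right_le (f := y)
      (f' := fun t => A t (coordClip R (y t))) (δ := ‖y₀‖) (K := M) (ε := 0) (a := 0) (b := T)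
      (fun x hx => (hy x hx).continuousWithinAt)
      (fun x hx => (hy x (Ico_subset_Icc_self hx)).mono_of_mem_nhdsWithin
        (Icc_mem_nhdsGE_of_mem hx)) (by simpa using (congrArg norm hy0).le)
      (fun x hx => by
        rw [add_zero]
        exact ((A x).le_of_opNorm_le (hM x (Ico_subset_Icc_self hx)) _).trans
          (mul_le_mul_of_nonneg_left (norm_coordClip_le_norm R.2 _) M.2)) t ht
    rw [gronwallBound_ε0, sub_zero] at h
    refine h.trans ?_
    rw [hRdef, NNReal.coe_mk]
    have := ht.2
    gcongr
  have h := hy t ht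
  simp only [coordClip_eq_self (hbound t ht)] at h
  exact h

/-- Global forward existence for linear ODEs with continuous coefficients. -/
theorem exists_hasDerivAt_linear {A : ℝ → (ι → ℝ) →L[ℝ] (ι → ℝ)}
    (hA : ContinuousOn A (Ici 0)) (y₀ : ι → ℝ) :
    ∃ y : ℝ → ι → ℝ, y 0 = y₀ ∧ ContinuousOn y (Ici 0) ∧
      ∀ t > 0, HasDerivAt y (A t (y t)) t := by
  have hA' : ∀ T, ContinuousOn A (Icc 0 T) := fun T => hA.mono Icc_subset_Ici_self
  choose Y hY0 hY using fun n : ℕ =>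
    exists_hasDerivWithinAt_linear_Icc (T := (n : ℝ) + 1) (by positivity) (hA' _) y₀
  have hYd : ∀ n : ℕ, ∀ t ∈ Ioo 0 ((n : ℝ) + 1), HasDerivAt (Y n) (A t (Y n t)) t :=
    fun n t ht => (hY n t (Ioo_subset_Icc_self ht)).hasDerivAt (Icc_mem_nhds ht.1 ht.2)
  have hYlim : ∀ n : ℕ, Tendsto (Y n) (𝓝[>] 0) (𝓝 y₀) := by
    intro n
    have hn : (0 : ℝ) < n + 1 := by positivity
    have := (hY n 0 ⟨le_rfl, hn.le⟩).continuousWithinAt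
    rw [ContinuousWithinAt, hY0] at this
    exact this.mono_left (nhdsWithin_le_of_mem (mem_of_superset (Ioo_mem_nhdsGT hn)
      Ioo_subset_Icc_self))
  have hagree : ∀ n m : ℕ, n ≤ m → ∀ t ∈ Ioo 0 ((n : ℝ) + 1), Y n t = Y m t := by
    intro n m hnm
    have hnm' : (n : ℝ) ≤ m := by exact_mod_cast hnm
    exact eq_of_hasDerivAt_linear (hA' _) (hYd n)
      (fun t ht => hYd m t ⟨ht.1, by linarith [ht.2]⟩) (hYlim n) (hYlim m)
  set y : ℝ → ι → ℝ := fun t => Y ⌊t⌋₊ t with hydef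
  have hy : ∀ n : ℕ, ∀ t ∈ Ioo 0 ((n : ℝ) + 1), y t = Y n t := by
    intro n t ht
    rcases le_total ⌊t⌋₊ n with h | h
    · exact hagree _ _ h t ⟨ht.1, Nat.lt_floor_add_one t⟩
    · exact (hagree _ _ h t ht).symm
  have hder : ∀ t > 0, HasDerivAt y (A t (y t)) t := by
    intro t ht
    have hmem : t ∈ Ioo 0 ((⌊t⌋₊ : ℝ) + 1) := ⟨ht, Nat.lt_floor_add_one t⟩
    refine (hYd _ t hmem).congr_of_eventuallyEq ?_
    filter_upwards [isOpen_Ioo.mem_nhds hmem] with s hs using hy _ s hs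
  have hy0 : y 0 = y₀ := by simp [hydef, hY0]
  refine ⟨y, hy0, fun t ht => ?_, hder⟩
  rcases eq_or_lt_of_le (mem_Ici.mp ht) with rfl | ht
  · rw [← continuousWithinAt_Ioi_iff_Ici, ContinuousWithinAt, hy0]
    refine (hYlim 0).congr' ?_
    filter_upwards [Ioo_mem_nhdsGT (by positivity : (0 : ℝ) < ((0 : ℕ) : ℝ) + 1)] with s hs
    exact (hy 0 s hs).symm
  · exact (hder t ht).continuousAt.continuousWithinAt

end LinearODE

section ModeSystem

theorem continuousOn_mul_log_sq : ContinuousOn (fun t : ℝ => t * Real.log t ^ 2) (Ici 0) := by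
  have h : Continuous fun t : ℝ => 4 * (√t * Real.log √t) ^ 2 := by
    have := Real.continuous_mul_log.comp Real.continuous_sqrt
    exact continuous_const.mul (this.pow 2)
  refine h.continuousOn.congr fun t ht => ?_
  have hnn : (0 : ℝ) ≤ t := ht
  simp only [mul_pow, Real.sq_sqrt hnn, Real.log_sqrt hnn]
  ring

/-- The coefficient matrix of the system satisfied by `(a - τ a' log τ, τ a', c)`, where `k` is
the total potential. -/
noncomputable def modeMatrix (k f₁ f₃ : ℝ → ℝ) (t : ℝ) : Matrix (Fin 3) (Fin 3) ℝ :=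
  !![k t * (t * Real.log t), k t * (t * Real.log t ^ 2) - f₁ t * (t * Real.log t),
      -(f₃ t * (t * Real.log t));
    -(k t * t), f₁ t * t - k t * (t * Real.log t), f₃ t * t;
    2 * t, 2 * (t * Real.log t), 0]

/-- `modeMatrix` as a continuous linear map. -/
noncomputable def modeCLM (k f₁ f₃ : ℝ → ℝ) (t : ℝ) : (Fin 3 → ℝ) →L[ℝ] (Fin 3 → ℝ) :=
  (Matrix.toLin'.trans LinearMap.toContinuousLinearMap) (modeMatrix k f₁ f₃ t)

theorem modeCLM_apply (k f₁ f₃ : ℝ → ℝ) (t : ℝ) (y : Fin 3 → ℝ) :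
    modeCLM k f₁ f₃ t y =
      ![-(Real.log t * (t * (-k t * (y 0 + y 1 * Real.log t) + f₁ t * y 1 + f₃ t * y 2))),
        t * (-k t * (y 0 + y 1 * Real.log t) + f₁ t * y 1 + f₃ t * y 2),
        2 * t * (y 0 + y 1 * Real.log t)] := by
  have : modeCLM k f₁ f₃ t y = (modeMatrix k f₁ f₃ t).mulVec y := rfl
  rw [this]
  funext i
  fin_cases i <;> simp [modeMatrix, Matrix.mulVec, dotProduct, Fin.sum_univ_three] <;> ring

theorem continuousOn_modeCLM {k f₁ f₃ : ℝ → ℝ} (hk : ContinuousOn k (Ici 0))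
    (h₁ : ContinuousOn f₁ (Ici 0)) (h₃ : ContinuousOn f₃ (Ici 0)) :
    ContinuousOn (modeCLM k f₁ f₃) (Ici 0) := by
  have hl : ContinuousOn (fun t : ℝ => t * Real.log t) (Ici 0) :=
    Real.continuous_mul_log.continuousOn
  have hl2 := continuousOn_mul_log_sq
  have hid : ContinuousOn (fun t : ℝ => t) (Ici 0) := continuousOn_id
  have hM : ContinuousOn (modeMatrix k f₁ f₃) (Ici 0) := by
    refine continuousOn_pi.mpr fun i => continuousOn_pi.mpr fun j => ?_
    fin_cases i <;> fin_cases j <;> simp only [modeMatrix] <;> simp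
    · exact hk.mul hl
    · exact (hk.mul hl2).sub (h₁.mul hl)
    · exact (h₃.mul hl).neg
    · exact (hk.mul hid).neg
    · exact (h₁.mul hid).sub (hk.mul hl)
    · exact h₃.mul hid
    · exact continuousOn_const.mul hid
    · exact continuousOn_const.mul hl
    · exact continuousOn_const
  exact (LinearMap.continuous_of_finiteDimensional
    (Matrix.toLin'.trans LinearMap.toContinuousLinearMap :
      Matrix (Fin 3) (Fin 3) ℝ ≃ₗ[ℝ] ((Fin 3 → ℝ) →L[ℝ] (Fin 3 → ℝ))).toLinearMap).comp_continuousOn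
    hM

/-- The total zeroth-order coefficient of the wave equation. -/
noncomputable def modePotential (q' lam : ℝ) (f₂ : ℝ → ℝ) (t : ℝ) : ℝ :=
  4 * q' + 4 * lam ^ 2 * ((t ^ 2 + 1) ^ 2)⁻¹ - f₂ t * t ^ 2

theorem continuousOn_modePotential (q' lam : ℝ) {f₂ : ℝ → ℝ} (h₂ : ContinuousOn f₂ (Ici 0)) :
    ContinuousOn (modePotential q' lam f₂) (Ici 0) := by
  have : Continuous fun t : ℝ => 4 * q' + 4 * lam ^ 2 * ((t ^ 2 + 1) ^ 2)⁻¹ :=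
    continuous_const.add (continuous_const.mul
      ((by fun_prop : Continuous fun t : ℝ => (t ^ 2 + 1) ^ 2).inv₀ fun t => by positivity))
  exact this.continuousOn.sub (h₂.mul (by fun_prop))

/-- A solution of the mode system yields a solution of the regularised linear system. -/
theorem SolvesModelSystem.hasDerivAt_modeCLM {q' lam : ℝ} {f₁ f₂ f₃ a c : ℝ → ℝ}
    (h : SolvesModelSystem q' f₁ f₂ f₃ lam a c (Ioi 0)) {t : ℝ} (ht : 0 < t) :
    HasDerivAt (fun τ => ![a τ - τ * deriv a τ * Real.log τ, τ * deriv a τ, c τ])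
      (modeCLM (modePotential q' lam f₂) f₁ f₃ t
        ![a t - t * deriv a t * Real.log t, t * deriv a t, c t]) t := by
  obtain ⟨ha, ha', hc, hE, hC⟩ := h t ht
  have hu : HasDerivAt (fun τ => τ * deriv a τ) (1 * deriv a t + t * deriv (deriv a) t) t :=
    (hasDerivAt_id t).mul ha'.hasDerivAt
  have hb := ha.hasDerivAt.sub (hu.mul (Real.hasDerivAt_log ht.ne'))
  have hc' := hc.hasDerivAt
  have hE' : 1 * deriv a t + t * deriv (deriv a) t
      = t * (-modePotential q' lam f₂ t * a t + f₁ t * (t * deriv a t) + f₃ t * c t) := by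
    have : deriv (deriv a) t = f₁ t * t * deriv a t + f₂ t * t ^ 2 * a t + f₃ t * c t
      - t⁻¹ * deriv a t - 4 * q' * a t - 4 * lam ^ 2 * ((t ^ 2 + 1) ^ 2)⁻¹ * a t := by linarith
    rw [this, modePotential]
    have := mul_inv_cancel₀ ht.ne'
    linear_combination (-deriv a t) * this
  rw [modeCLM_apply, hasDerivAt_pi]
  intro i
  fin_cases i
  · refine hb.congr_deriv ?_
    simp only [Fin.zero_eta, Matrix.cons_val_zero, Matrix.cons_val_one, Matrix.cons_val]
    rw [sub_add_cancel, hE']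
    have := mul_inv_cancel₀ ht.ne'
    linear_combination (-deriv a t) * this
  · refine hu.congr_deriv ?_
    simp only [Fin.mk_one, Matrix.cons_val_zero, Matrix.cons_val_one, Matrix.cons_val]
    rw [sub_add_cancel, hE']
  · refine hc'.congr_deriv ?_
    simp only [Fin.reduceFinMk, Matrix.cons_val_zero, Matrix.cons_val_one, Matrix.cons_val]
    rw [sub_add_cancel, hC]

/-- The asymptotic data are the initial values of the regularised linear system. -/
theorem HasAsymptoticData.tendsto {a c : ℝ → ℝ} {c₀ O h : ℝ} (H : HasAsymptoticData a c c₀ O h) :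
    Tendsto (fun τ => ![a τ - τ * deriv a τ * Real.log τ, τ * deriv a τ, c τ])
      (𝓝[>] 0) (𝓝 ![h, O, c₀]) := by
  obtain ⟨hc, hc0, K, hK, hb⟩ := H
  have hlog : Tendsto (fun t : ℝ => t * Real.log t) (𝓝[>] 0) (𝓝 0) := by
    have := Real.continuous_mul_log.tendsto 0
    simp only [zero_mul] at this
    exact this.mono_left nhdsWithin_le_nhds
  have hlog2 : Tendsto (fun t : ℝ => t * Real.log t ^ 2) (𝓝[>] 0) (𝓝 0) := by
    have := continuousOn_mul_log_sq 0 self_mem_Ici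
    simp only [ContinuousWithinAt, zero_mul] at this
    exact this.mono_left (nhdsWithin_mono _ Ioi_subset_Ici_self)
  have hid : Tendsto (fun t : ℝ => t) (𝓝[>] 0) (𝓝 0) := tendsto_id.mono_left nhdsWithin_le_nhds
  have hmem : ∀ᶠ t : ℝ in 𝓝[>] 0, t ∈ Ioc (0 : ℝ) 1 := Ioc_mem_nhdsGT one_pos
  have hu' : ∀ t ∈ Ioc (0 : ℝ) 1, |t * deriv a t - O| ≤ K * t ^ 2 * (1 + Real.log t ^ 2) := by
    intro t ht
    have : t * deriv a t - O = t * (deriv a t - O / t) := by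
      have := ht.1.ne'
      field_simp
    rw [this, abs_mul, abs_of_pos ht.1]
    calc t * |deriv a t - O / t| ≤ t * (K * t * (1 + Real.log t ^ 2)) :=
          mul_le_mul_of_nonneg_left (hb t ht).2 ht.1.le
      _ = _ := by ring
  have hu : Tendsto (fun t => t * deriv a t) (𝓝[>] 0) (𝓝 O) := by
    rw [tendsto_iff_norm_sub_tendsto_zero]
    have hlim : Tendsto (fun t : ℝ => K * (t * (t + t * Real.log t ^ 2))) (𝓝[>] 0) (𝓝 0) := by
      simpa using (hid.mul (hid.add hlog2)).const_mul K
    refine squeeze_zero' (Eventually.of_forall fun t => norm_nonneg _) ?_ hlim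
    filter_upwards [hmem] with t ht
    refine (hu' t ht).trans_eq ?_
    ring
  have hbb : Tendsto (fun t => a t - t * deriv a t * Real.log t) (𝓝[>] 0) (𝓝 h) := by
    rw [tendsto_iff_norm_sub_tendsto_zero]
    have hlim : Tendsto (fun t : ℝ => K * ((t + t * Real.log t ^ 2) * (t + |t * Real.log t|)))
        (𝓝[>] 0) (𝓝 0) := by
      simpa using ((hid.add hlog2).mul (hid.add hlog.abs)).const_mul K
    refine squeeze_zero' (Eventually.of_forall fun t => norm_nonneg _) ?_ hlim
    filter_upwards [hmem] with t ht
    have h1 := (hb t ht).1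
    have h2 : |(t * deriv a t - O) * Real.log t|
        ≤ K * t ^ 2 * (1 + Real.log t ^ 2) * |Real.log t| := by
      rw [abs_mul]
      exact mul_le_mul_of_nonneg_right (hu' t ht) (abs_nonneg _)
    calc ‖a t - t * deriv a t * Real.log t - h‖
        = |(a t - O * Real.log t - h) - (t * deriv a t - O) * Real.log t| := by
          rw [Real.norm_eq_abs]; congr 1; ring
      _ ≤ _ := abs_sub _ _
      _ ≤ _ := add_le_add h1 h2
      _ = _ := by rw [abs_mul, abs_of_pos ht.1]; ring
  have hcc : Tendsto c (𝓝[>] 0) (𝓝 c₀) := by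
    have := hc 0 self_mem_Ici
    rw [ContinuousWithinAt, hc0] at this
    exact this.mono_left (nhdsWithin_mono _ Ioi_subset_Ici_self)
  rw [tendsto_pi_nhds]
  intro i
  fin_cases i
  · exact hbb
  · exact hu
  · exact hcc

/-- Mean value estimate from `0` for a derivative controlled by a monotone function. -/
theorem abs_sub_le_mul_of_monotoneOn {g g' φ : ℝ → ℝ} (hg : ContinuousOn g (Icc 0 1))
    (hg' : ∀ t ∈ Ioo (0 : ℝ) 1, HasDerivAt g (g' t) t) (hφ : MonotoneOn φ (Ioc 0 1))
    (hle : ∀ t ∈ Ioo (0 : ℝ) 1, |g' t| ≤ φ t) {x : ℝ} (hx : x ∈ Ioc (0 : ℝ) 1) :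
    |g x - g 0| ≤ x * φ x := by
  obtain ⟨s, hs, hslope⟩ := exists_hasDerivAt_eq_slope g g' hx.1
    (hg.mono (Icc_subset_Icc_right hx.2)) (fun t ht => hg' t ⟨ht.1, ht.2.trans_le hx.2⟩)
  have hs1 : s ∈ Ioo (0 : ℝ) 1 := ⟨hs.1, hs.2.trans_le hx.2⟩
  have : g x - g 0 = x * g' s := by
    rw [hslope]
    have := hx.1.ne'
    field_simp
    simp
  rw [this, abs_mul, abs_of_pos hx.1]
  exact mul_le_mul_of_nonneg_left
    ((hle s hs1).trans (hφ ⟨hs1.1, hs1.2.le⟩ hx hs.2.le)) hx.1.le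

theorem monotoneOn_mul_one_sub_log :
    MonotoneOn (fun t : ℝ => t * (1 - Real.log t)) (Ioc 0 1) := by
  have hd : ∀ t : ℝ, 0 < t → HasDerivAt (fun t : ℝ => t * (1 - Real.log t)) (-Real.log t) t := by
    intro t ht
    refine ((hasDerivAt_id t).mul ((Real.hasDerivAt_log ht.ne').const_sub 1)).congr_deriv ?_
    have := ht.ne'
    simp
    field_simp
    ring
  refine monotoneOn_of_deriv_nonneg (convex_Ioc 0 1)
    (fun t ht => (hd t ht.1).continuousAt.continuousWithinAt) ?_ ?_ <;> rw [interior_Ioc]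
  · exact fun t ht => (hd t ht.1).differentiableAt.differentiableWithinAt
  · intro t ht
    rw [(hd t ht.1).deriv]
    linarith [Real.log_nonpos ht.1.le ht.2.le]

theorem monotoneOn_mul_one_add_log_sq :
    MonotoneOn (fun t : ℝ => t * (1 + Real.log t ^ 2)) (Ioc 0 1) := by
  have hd : ∀ t : ℝ, 0 < t →
      HasDerivAt (fun t : ℝ => t * (1 + Real.log t ^ 2)) ((1 + Real.log t) ^ 2) t := by
    intro t ht
    refine ((hasDerivAt_id t).mul (((Real.hasDerivAt_log ht.ne').pow 2).const_add 1)).congr_deriv ?_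
    have := ht.ne'
    simp
    field_simp
    ring
  refine monotoneOn_of_deriv_nonneg (convex_Ioc 0 1)
    (fun t ht => (hd t ht.1).continuousAt.continuousWithinAt) ?_ ?_ <;> rw [interior_Ioc]
  · exact fun t ht => (hd t ht.1).differentiableAt.differentiableWithinAt
  · intro t ht
    rw [(hd t ht.1).deriv]
    positivity

section Reconstruction

variable {k f₁ f₃ : ℝ → ℝ} {y : ℝ → Fin 3 → ℝ}

/-- The right-hand side `(τ a')'` of the wave equation in terms of the regularised unknowns. -/
noncomputable def modeForcing (k f₁ f₃ : ℝ → ℝ) (y : ℝ → Fin 3 → ℝ) (t : ℝ) : ℝ :=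
  t * (-k t * (y t 0 + y t 1 * Real.log t) + f₁ t * y t 1 + f₃ t * y t 2)

theorem hasDerivAt_mode_components
    {t : ℝ} (h : HasDerivAt y (modeCLM k f₁ f₃ t (y t)) t) :
    HasDerivAt (fun τ => y τ 0) (-(Real.log t * modeForcing k f₁ f₃ y t)) t ∧
    HasDerivAt (fun τ => y τ 1) (modeForcing k f₁ f₃ y t) t ∧
    HasDerivAt (fun τ => y τ 2) (2 * t * (y t 0 + y t 1 * Real.log t)) t := by
  rw [modeCLM_apply, hasDerivAt_pi] at h
  exact ⟨h 0, h 1, h 2⟩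

theorem hasDerivAt_mode_field {t : ℝ} (ht : 0 < t)
    (h : HasDerivAt y (modeCLM k f₁ f₃ t (y t)) t) :
    HasDerivAt (fun τ => y τ 0 + y τ 1 * Real.log τ) (y t 1 / t) t := by
  obtain ⟨h0, h1, -⟩ := hasDerivAt_mode_components h
  refine (h0.add (h1.mul (Real.hasDerivAt_log ht.ne'))).congr_deriv ?_
  ring

theorem hasDerivAt_deriv_mode_field (h : ∀ t > 0, HasDerivAt y (modeCLM k f₁ f₃ t (y t)) t)
    {t : ℝ} (ht : 0 < t) :
    HasDerivAt (deriv fun τ => y τ 0 + y τ 1 * Real.log τ)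
      ((modeForcing k f₁ f₃ y t * t - y t 1) / t ^ 2) t := by
  obtain ⟨-, h1, -⟩ := hasDerivAt_mode_components (h t ht)
  have := h1.div (hasDerivAt_id t) ht.ne'
  simp only [id, mul_one] at this
  refine this.congr_of_eventuallyEq ?_
  filter_upwards [lt_mem_nhds ht] with s hs
  exact (hasDerivAt_mode_field hs (h s hs)).deriv

theorem continuousOn_modeForcing (hk : ContinuousOn k (Ici 0)) (h₁ : ContinuousOn f₁ (Ici 0))
    (h₃ : ContinuousOn f₃ (Ici 0)) (hy : ContinuousOn y (Ici 0)) :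
    ContinuousOn (modeForcing k f₁ f₃ y) (Ioi 0) := by
  have hs : Ioi (0 : ℝ) ⊆ Ici 0 := Ioi_subset_Ici_self
  have hk := hk.mono hs
  have h₁ := h₁.mono hs
  have h₃ := h₃.mono hs
  have hc := fun i => (continuousOn_pi.mp hy i).mono hs
  have hlog : ContinuousOn Real.log (Ioi 0) := fun t ht =>
    (Real.continuousAt_log (ne_of_gt ht)).continuousWithinAt
  exact continuousOn_id.mul (((hk.neg.mul ((hc 0).add ((hc 1).mul hlog))).add
    (h₁.mul (hc 1))).add (h₃.mul (hc 2)))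

theorem contDiffAt_mode_field (hk : ContinuousOn k (Ici 0)) (h₁ : ContinuousOn f₁ (Ici 0))
    (h₃ : ContinuousOn f₃ (Ici 0)) (hy : ContinuousOn y (Ici 0))
    (h : ∀ t > 0, HasDerivAt y (modeCLM k f₁ f₃ t (y t)) t) :
    ∀ t ∈ Ioi (0 : ℝ), ContDiffAt ℝ 2 (fun τ => y τ 0 + y τ 1 * Real.log τ) t := by
  set a : ℝ → ℝ := fun τ => y τ 0 + y τ 1 * Real.log τ
  have hdd : ContinuousOn (deriv (deriv a)) (Ioi 0) := by
    have : ContinuousOn (fun t => (modeForcing k f₁ f₃ y t * t - y t 1) / t ^ 2) (Ioi 0) :=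
      (((continuousOn_modeForcing hk h₁ h₃ hy).mul continuousOn_id).sub
        ((continuousOn_pi.mp hy 1).mono Ioi_subset_Ici_self)).div
        (continuousOn_id.pow 2) fun t ht => pow_ne_zero 2 (ne_of_gt ht)
    exact this.congr fun t ht => (hasDerivAt_deriv_mode_field h ht).deriv
  have h1 : ContDiffOn ℝ 1 (deriv a) (Ioi 0) := by
    rw [show (1 : WithTop ℕ∞) = 0 + 1 by norm_num, contDiffOn_succ_iff_deriv_of_isOpen isOpen_Ioi]
    exact ⟨fun t ht =>
      (hasDerivAt_deriv_mode_field h ht).differentiableAt.differentiableWithinAt,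
      by simp, contDiffOn_zero.mpr hdd⟩
  have h2 : ContDiffOn ℝ 2 a (Ioi 0) := by
    rw [show (2 : WithTop ℕ∞) = 1 + 1 by norm_num, contDiffOn_succ_iff_deriv_of_isOpen isOpen_Ioi]
    exact ⟨fun t ht =>
      (hasDerivAt_mode_field ht (h t ht)).differentiableAt.differentiableWithinAt, by simp, h1⟩
  exact fun t ht => h2.contDiffAt (isOpen_Ioi.mem_nhds ht)

theorem solvesModelSystem_of_hasDerivAt {q' lam : ℝ} {f₂ : ℝ → ℝ}
    (h : ∀ t > 0, HasDerivAt y (modeCLM (modePotential q' lam f₂) f₁ f₃ t (y t)) t) :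
    SolvesModelSystem q' f₁ f₂ f₃ lam (fun τ => y τ 0 + y τ 1 * Real.log τ)
      (fun τ => y τ 2) (Ioi 0) := by
  intro t ht
  have hf := hasDerivAt_mode_field ht (h t ht)
  have hf' := hasDerivAt_deriv_mode_field h ht
  obtain ⟨-, -, h2⟩ := hasDerivAt_mode_components (h t ht)
  refine ⟨hf.differentiableAt, hf'.differentiableAt, h2.differentiableAt, ?_, h2.deriv⟩
  rw [hf'.deriv, hf.deriv, modeForcing, modePotential]
  have : t ≠ 0 := ne_of_gt ht
  have h3 : (t ^ 2 + 1) ≠ 0 := by positivity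
  field_simp
  ring

theorem hasAsymptoticData_of_hasDerivAt (hk : ContinuousOn k (Ici 0))
    (h₁ : ContinuousOn f₁ (Ici 0)) (h₃ : ContinuousOn f₃ (Ici 0)) (hy : ContinuousOn y (Ici 0))
    (h : ∀ t > 0, HasDerivAt y (modeCLM k f₁ f₃ t (y t)) t) :
    HasAsymptoticData (fun τ => y τ 0 + y τ 1 * Real.log τ) (fun τ => y τ 2)
      (y 0 2) (y 0 1) (y 0 0) := by
  have hs : Icc (0 : ℝ) 1 ⊆ Ici 0 := Icc_subset_Ici_self
  obtain ⟨B, hB⟩ := isCompact_Icc.exists_bound_of_continuousOn (hy.mono hs)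
  obtain ⟨M, hM⟩ := isCompact_Icc.exists_bound_of_continuousOn (hk.mono hs)
  obtain ⟨N₁, hN₁⟩ := isCompact_Icc.exists_bound_of_continuousOn (h₁.mono hs)
  obtain ⟨N₃, hN₃⟩ := isCompact_Icc.exists_bound_of_continuousOn (h₃.mono hs)
  have h01 : (0 : ℝ) ∈ Icc (0 : ℝ) 1 := ⟨le_rfl, zero_le_one⟩
  have hB0 : 0 ≤ B := (norm_nonneg _).trans (hB 0 h01)
  have hM0 : 0 ≤ M := (norm_nonneg _).trans (hM 0 h01)
  have hN₁0 : 0 ≤ N₁ := (norm_nonneg _).trans (hN₁ 0 h01)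
  have hN₃0 : 0 ≤ N₃ := (norm_nonneg _).trans (hN₃ 0 h01)
  have hBi : ∀ t ∈ Icc (0 : ℝ) 1, ∀ i, |y t i| ≤ B := fun t ht i =>
    (norm_le_pi_norm (y t) i).trans (hB t ht)
  set C : ℝ := (M + N₁ + N₃) * B
  have hC0 : 0 ≤ C := by positivity
  have hforce : ∀ t ∈ Ioc (0 : ℝ) 1,
      |modeForcing k f₁ f₃ y t| ≤ C * (t * (1 - Real.log t)) := by
    intro t ht
    have ht' := Ioc_subset_Icc_self ht
    have hl := Real.log_nonpos ht.1.le ht.2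
    have e1 : |y t 0 + y t 1 * Real.log t| ≤ B * (1 - Real.log t) := by
      refine (abs_add_le _ _).trans ?_
      rw [abs_mul, abs_of_nonpos hl]
      nlinarith [hBi t ht' 0, hBi t ht' 1]
    have e2 : |-k t * (y t 0 + y t 1 * Real.log t)| ≤ M * (B * (1 - Real.log t)) := by
      rw [abs_mul, abs_neg]
      exact mul_le_mul (hM t ht') e1 (abs_nonneg _) hM0
    have e3 : |f₁ t * y t 1| ≤ N₁ * B := by
      rw [abs_mul]
      exact mul_le_mul (hN₁ t ht') (hBi t ht' 1) (abs_nonneg _) hN₁0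
    have e4 : |f₃ t * y t 2| ≤ N₃ * B := by
      rw [abs_mul]
      exact mul_le_mul (hN₃ t ht') (hBi t ht' 2) (abs_nonneg _) hN₃0
    have e5 := abs_add_three (-k t * (y t 0 + y t 1 * Real.log t)) (f₁ t * y t 1) (f₃ t * y t 2)
    have e6 : (N₁ + N₃) * B ≤ (N₁ + N₃) * B * (1 - Real.log t) :=
      le_mul_of_one_le_right (by positivity) (by linarith)
    rw [modeForcing, abs_mul, abs_of_pos ht.1]
    calc _ ≤ t * (C * (1 - Real.log t)) :=
          mul_le_mul_of_nonneg_left (by simp only [C]; linarith) ht.1.le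
      _ = _ := by ring
  have hyc := fun i => (continuousOn_pi.mp hy i).mono hs
  have hu : ∀ t ∈ Ioc (0 : ℝ) 1, |y t 1 - y 0 1| ≤ t * (C * (t * (1 - Real.log t))) :=
    fun t ht => abs_sub_le_mul_of_monotoneOn (φ := fun t => C * (t * (1 - Real.log t))) (hyc 1)
      (fun s hs => (hasDerivAt_mode_components (h s hs.1)).2.1)
      (fun s hs r hr hsr => mul_le_mul_of_nonneg_left (monotoneOn_mul_one_sub_log hs hr hsr) hC0)
      (fun s hs => hforce s (Ioo_subset_Ioc_self hs)) ht
  have hb : ∀ t ∈ Ioc (0 : ℝ) 1,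
      |y t 0 - y 0 0| ≤ t * (2 * C * (t * (1 + Real.log t ^ 2))) := by
    intro t ht
    refine abs_sub_le_mul_of_monotoneOn (φ := fun t => 2 * C * (t * (1 + Real.log t ^ 2))) (hyc 0)
      (fun s hs => (hasDerivAt_mode_components (h s hs.1)).1)
      (fun s hs r hr hsr => mul_le_mul_of_nonneg_left (monotoneOn_mul_one_add_log_sq hs hr hsr)
        (by positivity)) (fun s hs => ?_) ht
    have hl := Real.log_nonpos hs.1.le hs.2.le
    rw [abs_neg, abs_mul, abs_of_nonpos hl]
    have hCs : 0 ≤ C * s := mul_nonneg hC0 hs.1.le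
    calc -Real.log s * |modeForcing k f₁ f₃ y s|
        ≤ -Real.log s * (C * (s * (1 - Real.log s))) :=
          mul_le_mul_of_nonneg_left (hforce s (Ioo_subset_Ioc_self hs)) (by linarith)
      _ = C * s * (-Real.log s * (1 - Real.log s)) := by ring
      _ ≤ C * s * (2 * (1 + Real.log s ^ 2)) :=
          mul_le_mul_of_nonneg_left (by nlinarith [sq_nonneg (Real.log s + 1)]) hCs
      _ = _ := by ring
  refine ⟨continuousOn_pi.mp hy 2, rfl, 4 * C, by positivity, fun t ht => ?_⟩
  have hl := Real.log_nonpos ht.1.le ht.2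
  have hu := hu t ht
  have hb := hb t ht
  have hCt : 0 ≤ C * t := mul_nonneg hC0 ht.1.le
  constructor
  · have e1 : y t 0 + y t 1 * Real.log t - y 0 1 * Real.log t - y 0 0
        = (y t 0 - y 0 0) + (y t 1 - y 0 1) * Real.log t := by ring
    have e2 : |(y t 1 - y 0 1) * Real.log t|
        ≤ t * (C * (t * (1 - Real.log t))) * -Real.log t := by
      rw [abs_mul, abs_of_nonpos hl]
      exact mul_le_mul_of_nonneg_right hu (by linarith)
    have e3 : C * t * t * ((1 - Real.log t) * -Real.log t)
        ≤ C * t * t * (2 * (1 + Real.log t ^ 2)) :=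
      mul_le_mul_of_nonneg_left (by nlinarith [sq_nonneg (Real.log t + 1)])
        (mul_nonneg hCt ht.1.le)
    rw [e1]
    refine (abs_add_le _ _).trans ?_
    linarith
  · rw [(hasDerivAt_mode_field ht.1 (h t ht.1)).deriv, ← sub_div, abs_div, abs_of_pos ht.1,
      div_le_iff₀ ht.1]
    refine hu.trans ?_
    have e3 : C * t * t * (1 - Real.log t) ≤ C * t * t * (4 * (1 + Real.log t ^ 2)) :=
      mul_le_mul_of_nonneg_left (by nlinarith [sq_nonneg (Real.log t + 1)])
        (mul_nonneg hCt ht.1.le)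
    linarith

end Reconstruction

end ModeSystem

/-- Existence and uniqueness of scattering states for the model system (single-mode
version of Theorem 3.7 of the paper). -/
theorem existence_uniqueness_scattering_states (q' F : ℝ) (hq : 1 ≤ q') (hF : 0 ≤ F)
    (f₁ f₂ f₃ : ℝ → ℝ)
    (hf₁c : ContinuousOn f₁ (Ici 0)) (hf₂c : ContinuousOn f₂ (Ici 0))
    (hf₃c : ContinuousOn f₃ (Ici 0))
    (hf₁ : ∀ τ ≥ (0:ℝ), |f₁ τ| ≤ F) (hf₂ : ∀ τ ≥ (0:ℝ), |f₂ τ| ≤ F)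
    (hf₃ : ∀ τ ≥ (0:ℝ), |f₃ τ| ≤ F)
    (lam : ℝ) (hlam : 0 ≤ lam) (c₀ O h : ℝ) :
    (∃ a c : ℝ → ℝ,
      (∀ τ ∈ Ioi (0:ℝ), ContDiffAt ℝ 2 a τ) ∧ ContinuousOn c (Ici 0) ∧
      SolvesModelSystem q' f₁ f₂ f₃ lam a c (Ioi 0) ∧
      HasAsymptoticData a c c₀ O h) ∧
    (∀ a c a' c' : ℝ → ℝ,
      ((∀ τ ∈ Ioi (0:ℝ), ContDiffAt ℝ 2 a τ) ∧ ContinuousOn c (Ici 0) ∧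
        SolvesModelSystem q' f₁ f₂ f₃ lam a c (Ioi 0) ∧
        HasAsymptoticData a c c₀ O h) →
      ((∀ τ ∈ Ioi (0:ℝ), ContDiffAt ℝ 2 a' τ) ∧ ContinuousOn c' (Ici 0) ∧
        SolvesModelSystem q' f₁ f₂ f₃ lam a' c' (Ioi 0) ∧
        HasAsymptoticData a' c' c₀ O h) →
      (∀ τ > (0:ℝ), a τ = a' τ) ∧ (∀ τ ≥ (0:ℝ), c τ = c' τ)) := by
  have hk := continuousOn_modePotential q' lam hf₂c
  have hA := continuousOn_modeCLM hk hf₁c hf₃c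
  constructor
  · obtain ⟨y, hy0, hyc, hy⟩ := exists_hasDerivAt_linear hA ![h, O, c₀]
    refine ⟨_, _, contDiffAt_mode_field hk hf₁c hf₃c hyc hy, continuousOn_pi.mp hyc 2,
      solvesModelSystem_of_hasDerivAt hy, ?_⟩
    have := hasAsymptoticData_of_hasDerivAt hk hf₁c hf₃c hyc hy
    rw [hy0] at this
    simpa using this
  · rintro a c a' c' ⟨-, -, hs, hd⟩ ⟨-, -, hs', hd'⟩
    have key : ∀ τ > (0 : ℝ), a τ = a' τ ∧ c τ = c' τ := by
      intro τ hτ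
      have := eq_of_hasDerivAt_linear (T := τ + 1) (hA.mono Icc_subset_Ici_self)
        (fun t ht => hs.hasDerivAt_modeCLM ht.1) (fun t ht => hs'.hasDerivAt_modeCLM ht.1)
        hd.tendsto hd'.tendsto τ ⟨hτ, by linarith⟩
      have e0 := congrFun this 0
      have e1 := congrFun this 1
      have e2 := congrFun this 2
      simp only [Matrix.cons_val_zero, Matrix.cons_val_one, Matrix.cons_val] at e0 e1 e2
      rw [e1] at e0
      exact ⟨by linarith, e2⟩
    refine ⟨fun τ hτ => (key τ hτ).1, fun τ hτ => ?_⟩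
    rcases eq_or_lt_of_le hτ with rfl | hτ
    · rw [hd.2.1, hd'.2.1]
    · exact (key τ hτ).2
end

section
/- Backward estimate on asymptotic data, single-mode version (Theorem 3.11 of the paper): there exists a constant C > 0, depending only on q' and F, such that for every λ ≥ 0 and every pair (a, c) solving the mode-λ model system on (0,∞) with asymptotic data (c₀, O, h) at τ = 0, setting 𝔥 := h − O·log√(1+λ²) (the single-mode version of the renormalization 𝔥 = h − (log∇)O), one has: (i) 𝔥² + O² ≤ C·( √(1+λ²)·a(1)² + (1+λ²)^(−1/2)·a'(1)² + (1+λ²)^(−1/2)·c(1)² ); (ii) √(1+λ²)·c₀² ≤ C·( √(1+λ²)·a(1)² + (1+λ²)^(−1/2)·a'(1)² + √(1+λ²)·c(1)² ). -/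
open Set Filter

open Real in
/-- A differential Grönwall inequality, run backwards from `v` to `u`. -/
theorem backward_gronwall {u v : ℝ} (huv : u ≤ v) {V V' G G' : ℝ → ℝ}
    (hV : ∀ t ∈ Icc u v, HasDerivAt V (V' t) t) (hG : ∀ t ∈ Icc u v, HasDerivAt G (G' t) t)
    (h : ∀ t ∈ Icc u v, -(G' t * V t) ≤ V' t) :
    V u * exp (G u) ≤ V v * exp (G v) := by
  have hd : ∀ t ∈ Icc u v, HasDerivAt (fun t => V t * exp (G t))
      (V' t * exp (G t) + V t * (exp (G t) * G' t)) t :=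
    fun t ht => (hV t ht).mul (hG t ht).exp
  have hmono : MonotoneOn (fun t => V t * exp (G t)) (Icc u v) := by
    refine monotoneOn_of_deriv_nonneg (convex_Icc u v)
      (fun t ht => (hd t ht).continuousAt.continuousWithinAt)
      (fun t ht => (hd t (interior_subset ht)).differentiableAt.differentiableWithinAt) ?_
    intro t ht
    have ht' := interior_subset ht
    rw [(hd t ht').deriv]
    have h1 := h t ht'
    have h2 : 0 ≤ (V' t + G' t * V t) * exp (G t) :=
      mul_nonneg (by linarith) (exp_pos _).le
    linarith
  exact hmono (left_mem_Icc.2 huv) (right_mem_Icc.2 huv) huv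

theorem abs_mul_abs_le_half_add_sq (x y : ℝ) : |x| * |y| ≤ (x ^ 2 + y ^ 2) / 2 := by
  rw [← sq_abs x, ← sq_abs y]
  linarith [two_mul_le_add_sq |x| |y|]

theorem abs_four_mul_le {k : ℝ} (hk : 0 ≤ k) (x y : ℝ) :
    |4 * k * x * y| ≤ 2 * k * (x ^ 2 + y ^ 2) := by
  rw [abs_mul, abs_mul, abs_of_nonneg (by positivity : 0 ≤ 4 * k), mul_assoc]
  have := mul_le_mul_of_nonneg_left (abs_mul_abs_le_half_add_sq x y)
    (by positivity : 0 ≤ 4 * k)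
  linarith

theorem mul_abs_mul_le_half {s w : ℝ} (hw : s ^ 2 ≤ w) (x y : ℝ) :
    s * |x * y| ≤ (y ^ 2 + w * x ^ 2) / 2 := by
  have h : s * |x * y| ≤ (y ^ 2 + s ^ 2 * x ^ 2) / 2 := by
    rw [abs_mul, ← sq_abs x, ← sq_abs y]
    nlinarith [sq_nonneg (|y| - s * |x|)]
  nlinarith [mul_le_mul_of_nonneg_right hw (sq_nonneg x)]

/-- The cross term `x * y` is controlled by half of the weighted energy. -/
theorem abs_mul_le_half_energy {s τ x y w : ℝ} (hτ : 0 < τ)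
    (hsτ : 1 ≤ τ * s) (hw : s ^ 2 ≤ w) :
    |x * y| ≤ τ * (y ^ 2 + w * x ^ 2) / 2 := by
  have h1 := mul_abs_mul_le_half hw x y
  have h2 : 1 * |x * y| ≤ τ * s * |x * y| := mul_le_mul_of_nonneg_right hsτ (abs_nonneg _)
  have h3 := mul_le_mul_of_nonneg_left h1 hτ.le
  linarith

/-- The pointwise differential inequality for the corrected energy in the oscillatory region. -/
theorem oscillatory_energy_inequality {F s κ τ x y c w w' g₁ g₂ g₃ : ℝ} (hs : 1 ≤ s)
    (hκ : 1 ≤ κ) (hκs : κ ≤ s ^ 2) (hτ : 0 < τ) (hτ1 : τ ≤ 1) (hsτ : 1 ≤ τ * s)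
    (hw : s ^ 2 ≤ w) (hw' : |w'| ≤ 16 * s ^ 2 * τ)
    (h₁ : |g₁| ≤ F) (h₂ : |g₂| ≤ F) (h₃ : |g₃| ≤ F) :
    -((36 + 12 * F + (s * τ ^ 2)⁻¹) * (τ * (y ^ 2 + w * x ^ 2) + x * y + κ * c ^ 2))
      ≤ -(x * y) / τ + τ * w' * x ^ 2
        + (2 * τ * y + x) * (g₁ * τ * y + g₂ * τ ^ 2 * x + g₃ * c) + 4 * κ * τ * x * c := by
  have hs0 : 0 < s := by linarith
  have hF : 0 ≤ F := (abs_nonneg _).trans h₁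
  have hhalf := abs_mul_le_half_energy (x := x) (y := y) hτ hsτ hw
  set E := τ * (y ^ 2 + w * x ^ 2) with hE
  have hc0 : c ^ 2 ≤ κ * c ^ 2 := le_mul_of_one_le_left (sq_nonneg c) hκ
  set D := κ * c ^ 2 with hD
  have hD0 : 0 ≤ D := (sq_nonneg c).trans hc0
  have hE0 : 0 ≤ E := by have := abs_nonneg (x * y); linarith
  have hy : τ * y ^ 2 ≤ E := by
    have : 0 ≤ τ * (w * x ^ 2) := by have := hw.trans' (sq_nonneg s); positivity
    linarith
  have hsx : τ * s ^ 2 * x ^ 2 ≤ E := by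
    have h1 := mul_le_mul_of_nonneg_left (mul_le_mul_of_nonneg_right hw (sq_nonneg x)) hτ.le
    have h2 : 0 ≤ τ * y ^ 2 := by positivity
    linarith
  have hx : x ^ 2 ≤ E := by
    have h1 : 1 * 1 ≤ τ * s * s := mul_le_mul hsτ hs zero_le_one (by positivity)
    have h2 := mul_le_mul_of_nonneg_right h1 (sq_nonneg x)
    linarith
  have hcross : |x * y| / τ ≤ (s * τ ^ 2)⁻¹ * (E / 2) := by
    have h2 : s * |x * y| * τ ≤ E / 2 := by
      have := mul_le_mul_of_nonneg_right (mul_abs_mul_le_half hw x y) hτ.le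
      linarith
    have h3 : |x * y| / τ = (s * τ ^ 2)⁻¹ * (s * |x * y| * τ) := by field_simp
    rw [h3]
    exact mul_le_mul_of_nonneg_left h2 (by positivity)
  have hxy : |x| * |y| * τ ≤ E / 2 := by
    rw [← abs_mul]
    have := mul_le_mul_of_nonneg_left hτ1 (abs_nonneg (x * y))
    linarith
  have hwt : |τ * w' * x ^ 2| ≤ 16 * E := by
    rw [abs_mul, abs_mul, abs_of_pos hτ, abs_of_nonneg (sq_nonneg x)]
    have h1 : τ * |w'| * x ^ 2 ≤ τ * (16 * s ^ 2 * τ) * x ^ 2 := by gcongr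
    have h2 : τ * (τ * s ^ 2 * x ^ 2) ≤ 1 * (τ * s ^ 2 * x ^ 2) :=
      mul_le_mul_of_nonneg_right hτ1 (by positivity)
    linarith
  have hR : |g₁ * τ * y + g₂ * τ ^ 2 * x + g₃ * c| ≤ F * (τ * |y| + τ ^ 2 * |x| + |c|) := by
    have a1 : |g₁ * τ * y| ≤ F * τ * |y| := by
      rw [abs_mul, abs_mul, abs_of_pos hτ]; gcongr
    have a2 : |g₂ * τ ^ 2 * x| ≤ F * τ ^ 2 * |x| := by
      rw [abs_mul, abs_mul, abs_of_nonneg (sq_nonneg τ)]; gcongr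
    have a3 : |g₃ * c| ≤ F * |c| := by rw [abs_mul]; gcongr
    have := abs_add_three (g₁ * τ * y) (g₂ * τ ^ 2 * x) (g₃ * c)
    linarith
  have hL : |2 * τ * y + x| ≤ 2 * τ * |y| + |x| := by
    have := abs_add_le (2 * τ * y) x
    rwa [abs_mul, abs_of_pos (by positivity : 0 < 2 * τ)] at this
  have hLR : |(2 * τ * y + x) * (g₁ * τ * y + g₂ * τ ^ 2 * x + g₃ * c)| ≤ F * (6 * (E + D)) := by
    rw [abs_mul]
    have h1 := mul_le_mul hL hR (abs_nonneg _) (by positivity)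
    have hττ : τ ^ 2 ≤ 1 := pow_le_one₀ hτ.le hτ1
    have hyc : τ * (|y| * |c|) ≤ (E + D) / 2 := by
      have := abs_mul_abs_le_half_add_sq y c
      have h2 := mul_le_mul_of_nonneg_left this hτ.le
      have h3 := mul_le_mul_of_nonneg_right hτ1 (sq_nonneg c)
      linarith
    have hxc : |x| * |c| ≤ (E + D) / 2 := by
      have := abs_mul_abs_le_half_add_sq x c
      linarith
    have hyy : τ ^ 2 * |y| ^ 2 ≤ E := by
      have := mul_le_mul_of_nonneg_right hτ1 (by positivity : 0 ≤ τ * y ^ 2)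
      rw [sq_abs]
      linarith
    have hxx : τ ^ 2 * |x| ^ 2 ≤ E := by
      have := mul_le_mul_of_nonneg_right hττ (sq_nonneg x)
      rw [sq_abs]
      linarith
    have hxy3 : τ ^ 2 * (|x| * |y| * τ) ≤ E / 2 := by
      have := mul_le_mul_of_nonneg_right hττ (by positivity : 0 ≤ |x| * |y| * τ)
      linarith
    refine h1.trans ?_
    have : (2 * τ * |y| + |x|) * (τ * |y| + τ ^ 2 * |x| + |c|) ≤ 6 * (E + D) := by
      linarith
    calc _ = F * ((2 * τ * |y| + |x|) * (τ * |y| + τ ^ 2 * |x| + |c|)) := by ring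
      _ ≤ _ := mul_le_mul_of_nonneg_left this hF
  have hlast : |4 * κ * τ * x * c| ≤ 2 * (E + D) := by
    have h1 := abs_four_mul_le (zero_le_one.trans hκ) (τ * x) c
    rw [mul_pow, ← mul_assoc] at h1
    have h2 : κ * (τ ^ 2 * x ^ 2) ≤ E := by
      have e1 : κ * (τ ^ 2 * x ^ 2) ≤ s ^ 2 * (τ ^ 2 * x ^ 2) := by gcongr
      have e2 : τ * (τ * s ^ 2 * x ^ 2) ≤ 1 * (τ * s ^ 2 * x ^ 2) :=
        mul_le_mul_of_nonneg_right hτ1 (by positivity)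
      linarith
    linarith
  have hlow : E / 2 + D ≤ E + x * y + D := by
    have := neg_abs_le (x * y); linarith
  have hinv : 0 ≤ (s * τ ^ 2)⁻¹ := by positivity
  have hmain : (36 + 12 * F + (s * τ ^ 2)⁻¹) * (E / 2 + D)
      ≤ (36 + 12 * F + (s * τ ^ 2)⁻¹) * (E + x * y + D) :=
    mul_le_mul_of_nonneg_left hlow (by positivity)
  have b1 : -(|x * y| / τ) ≤ -(x * y) / τ := by
    rw [← neg_div]; gcongr; exact le_abs_self _
  have b2 := neg_abs_le (τ * w' * x ^ 2)
  have b3 := neg_abs_le ((2 * τ * y + x) * (g₁ * τ * y + g₂ * τ ^ 2 * x + g₃ * c))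
  have b4 := neg_abs_le (4 * κ * τ * x * c)
  have hFE := mul_nonneg hF hE0
  have hFD := mul_nonneg hF hD0
  have hiD := mul_nonneg hinv hD0
  linarith

/-- The pointwise differential inequality for the renormalized quantities near `τ = 0`. -/
theorem renormalized_inequality {q F s μ τ x y c w l g₁ g₂ g₃ : ℝ} (hs : 1 ≤ s) (hq : 0 ≤ q)
    (hμ : 1 ≤ μ * s) (hμs : μ ≤ s) (hτ : 0 < τ) (hτ1 : τ ≤ 1)
    (hl : τ * s * (1 + l ^ 2) ≤ 5)
    (hw0 : 0 ≤ w) (hw : w ≤ 4 * q * s ^ 2)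
    (h₁ : |g₁| ≤ F) (h₂ : |g₂| ≤ F) (h₃ : |g₃| ≤ F) :
    -(5 * (8 * q + 6 * F + 4) * s * ((τ * y) ^ 2 + (x - τ * y * l) ^ 2 + μ * c ^ 2))
      ≤ 2 * (τ * y - (x - τ * y * l) * l) *
          (τ * (-w * x + (g₁ * τ * y + g₂ * τ ^ 2 * x + g₃ * c))) + 4 * μ * τ * x * c := by
  have hs0 : 0 < s := by linarith
  have hμ0 : 0 < μ := by
    by_contra! h
    nlinarith
  have hF : 0 ≤ F := (abs_nonneg _).trans h₁
  set p := τ * y with hp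
  set r := x - p * l with hr
  set u := p - r * l with hu
  set Y := p ^ 2 + r ^ 2 + μ * c ^ 2 with hY
  have hc0 : 0 ≤ μ * c ^ 2 := by positivity
  have hY0 : 0 ≤ Y := by positivity
  set N := (1 + l ^ 2) * Y with hN
  have hlY : 0 ≤ l ^ 2 * Y := by positivity
  have hYN : Y ≤ N := by linarith
  have hN0 : 0 ≤ N := hY0.trans hYN
  have hlc : 0 ≤ (1 + l ^ 2) * (μ * c ^ 2) := by positivity
  have hNx : N = x ^ 2 + (r * l - p) ^ 2 + (1 + l ^ 2) * (μ * c ^ 2) := by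
    rw [hN, hY, hr]; ring
  have hNu : N = u ^ 2 + (p * l + r) ^ 2 + (1 + l ^ 2) * (μ * c ^ 2) := by
    rw [hN, hY, hu]; ring
  clear_value p r u Y N
  have hx2 : x ^ 2 ≤ N := by have := sq_nonneg (r * l - p); linarith
  have hu2 : u ^ 2 ≤ N := by have := sq_nonneg (p * l + r); linarith
  have hp2 : p ^ 2 ≤ N := by have := sq_nonneg r; linarith
  have hμc : μ * c ^ 2 ≤ N := by have := sq_nonneg r; have := sq_nonneg p; linarith
  have hux : |u| * |x| ≤ N := by have := abs_mul_abs_le_half_add_sq u x; linarith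
  have hup : |u| * |p| ≤ N := by have := abs_mul_abs_le_half_add_sq u p; linarith
  have hcs : c ^ 2 ≤ s * N := by
    calc c ^ 2 = 1 * c ^ 2 := by ring
      _ ≤ (μ * s) * c ^ 2 := by gcongr
      _ = s * (μ * c ^ 2) := by ring
      _ ≤ s * N := by gcongr
  have hs1 : N ≤ s * N := le_mul_of_one_le_left hN0 hs
  have hs2 : s * N ≤ s ^ 2 * N := by
    have := mul_le_mul_of_nonneg_left hs1 hs0.le
    linarith
  have huc : |u| * |c| ≤ s ^ 2 * N := by
    have := abs_mul_abs_le_half_add_sq u c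
    linarith
  have hxc : |4 * μ * τ * x * c| ≤ τ * (4 * s ^ 2 * N) := by
    have h1 := abs_four_mul_le (mul_pos hμ0 hτ).le x c
    have h2 : μ * x ^ 2 ≤ s * N := mul_le_mul hμs hx2 (sq_nonneg _) hs0.le
    have h3 := mul_le_mul_of_nonneg_left
      (by linarith : 2 * (μ * x ^ 2 + μ * c ^ 2) ≤ 4 * s ^ 2 * N) hτ.le
    rw [← mul_assoc 4] at h1
    linarith
  have hR : |-w * x + (g₁ * τ * y + g₂ * τ ^ 2 * x + g₃ * c)|
      ≤ 4 * q * s ^ 2 * |x| + F * (|p| + |x| + |c|) := by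
    have a0 : |-w * x| ≤ 4 * q * s ^ 2 * |x| := by
      rw [abs_mul, abs_neg, abs_of_nonneg hw0]; gcongr
    have a1 : |g₁ * τ * y| ≤ F * |p| := by
      rw [mul_assoc, ← hp, abs_mul]; gcongr
    have a2 : |g₂ * τ ^ 2 * x| ≤ F * |x| := by
      rw [abs_mul, abs_mul, abs_of_nonneg (sq_nonneg τ)]
      have : |g₂| * τ ^ 2 ≤ F * 1 := by
        gcongr
        exact pow_le_one₀ hτ.le hτ1
      rw [mul_one] at this
      gcongr
    have a3 : |g₃ * c| ≤ F * |c| := by rw [abs_mul]; gcongr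
    have := abs_add_three (g₁ * τ * y) (g₂ * τ ^ 2 * x) (g₃ * c)
    have := abs_add_le (-w * x) (g₁ * τ * y + g₂ * τ ^ 2 * x + g₃ * c)
    linarith
  have hmain : |2 * u * (τ * (-w * x + (g₁ * τ * y + g₂ * τ ^ 2 * x + g₃ * c)))|
      ≤ τ * ((8 * q + 6 * F) * s ^ 2 * N) := by
    rw [abs_mul, abs_mul, abs_mul, abs_of_pos hτ, abs_two]
    calc 2 * |u| * (τ * |-w * x + (g₁ * τ * y + g₂ * τ ^ 2 * x + g₃ * c)|)
        ≤ 2 * |u| * (τ * (4 * q * s ^ 2 * |x| + F * (|p| + |x| + |c|))) := by gcongr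
      _ = τ * (8 * q * s ^ 2 * (|u| * |x|) + 2 * F * (|u| * |p| + |u| * |x| + |u| * |c|)) := by
        ring
      _ ≤ τ * (8 * q * s ^ 2 * N + 2 * F * (s ^ 2 * N + s ^ 2 * N + s ^ 2 * N)) := by
        have hup' := hup.trans (hs1.trans hs2)
        have hux' := hux.trans (hs1.trans hs2)
        refine mul_le_mul_of_nonneg_left (add_le_add ?_ ?_) hτ.le
        · exact mul_le_mul_of_nonneg_left hux (by positivity)
        · exact mul_le_mul_of_nonneg_left (by linarith) (by positivity)
      _ = _ := by ring
  have hfin : τ * (s ^ 2 * N) ≤ 5 * s * Y := by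
    calc τ * (s ^ 2 * N) = (τ * s * (1 + l ^ 2)) * (s * Y) := by rw [hN]; ring
      _ ≤ 5 * (s * Y) := by gcongr
      _ = _ := by ring
  have b1 := neg_abs_le (2 * u * (τ * (-w * x + (g₁ * τ * y + g₂ * τ ^ 2 * x + g₃ * c))))
  have b2 := neg_abs_le (4 * μ * τ * x * c)
  have hk : 0 ≤ 8 * q + 6 * F + 4 := by positivity
  have hkf := mul_le_mul_of_nonneg_left hfin hk
  linarith

theorem mul_one_add_log_sq_le {t : ℝ} (ht : 0 < t) (ht1 : t ≤ 1) :
    t * (1 + Real.log t ^ 2) ≤ 5 := by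
  have hr : 0 < √t := Real.sqrt_pos.2 ht
  have h1 : Real.log t = 2 * Real.log √t := by rw [Real.log_sqrt ht.le]; ring
  have h2 : 1 - (√t)⁻¹ ≤ Real.log √t := Real.one_sub_inv_le_log_of_pos hr
  have h3 : Real.log √t ≤ 0 := Real.log_nonpos hr.le (Real.sqrt_le_one.2 ht1)
  have h4 : √t * (√t)⁻¹ = 1 := mul_inv_cancel₀ hr.ne'
  have h5 : -1 ≤ √t * Real.log √t := by nlinarith
  have h6 : √t * Real.log √t ≤ 0 := mul_nonpos_of_nonneg_of_nonpos hr.le h3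
  have h7 : (√t) ^ 2 = t := Real.sq_sqrt ht.le
  have h8 : t * Real.log t ^ 2 = 4 * (√t * Real.log √t) ^ 2 := by
    rw [h1, mul_pow √t, h7]; ring
  nlinarith

theorem hasDerivAt_potential (q lam τ : ℝ) :
    HasDerivAt (fun t : ℝ => 4 * q + 4 * lam ^ 2 * ((t ^ 2 + 1) ^ 2)⁻¹)
      (-(16 * lam ^ 2 * τ * ((τ ^ 2 + 1) ^ 3)⁻¹)) τ := by
  have h1 : HasDerivAt (fun t : ℝ => (t ^ 2 + 1) ^ 2) (2 * (τ ^ 2 + 1) * (2 * τ)) τ := by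
    simpa using (((hasDerivAt_id τ).fun_pow 2).add_const 1).fun_pow 2
  have hne : (τ ^ 2 + 1) ^ 2 ≠ 0 := by positivity
  refine (((h1.fun_inv hne).const_mul (4 * lam ^ 2)).const_add (4 * q)).congr_deriv ?_
  field_simp
  ring

theorem potential_bounds {q lam s τ : ℝ} (hq : 1 ≤ q) (hs : s ^ 2 = 1 + lam ^ 2)
    (hτ : 0 < τ) (hτ1 : τ ≤ 1) :
    s ^ 2 ≤ 4 * q + 4 * lam ^ 2 * ((τ ^ 2 + 1) ^ 2)⁻¹ ∧
      4 * q + 4 * lam ^ 2 * ((τ ^ 2 + 1) ^ 2)⁻¹ ≤ 4 * q * s ^ 2 ∧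
      |-(16 * lam ^ 2 * τ * ((τ ^ 2 + 1) ^ 3)⁻¹)| ≤ 16 * s ^ 2 * τ := by
  have hl := sq_nonneg lam
  have ht2 : τ ^ 2 ≤ 1 := pow_le_one₀ hτ.le hτ1
  have h1 : ((τ ^ 2 + 1) ^ 2)⁻¹ ≤ 1 := inv_le_one_of_one_le₀ (by nlinarith [sq_nonneg τ])
  have h2 : (4 : ℝ)⁻¹ ≤ ((τ ^ 2 + 1) ^ 2)⁻¹ :=
    inv_anti₀ (by positivity) (by nlinarith [sq_nonneg τ])
  have h3 : ((τ ^ 2 + 1) ^ 3)⁻¹ ≤ 1 :=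
    inv_le_one_of_one_le₀ (one_le_pow₀ (by nlinarith [sq_nonneg τ]))
  have h4 := mul_le_mul_of_nonneg_left h1 hl
  have h5 := mul_le_mul_of_nonneg_left h2 hl
  have h6 := mul_le_mul_of_nonneg_right hq hl
  refine ⟨by linarith, by rw [hs]; linarith, ?_⟩
  rw [abs_neg, abs_of_nonneg (by positivity), hs]
  have h7 := mul_le_mul_of_nonneg_left h3 (by positivity : 0 ≤ 16 * lam ^ 2 * τ)
  linarith

namespace SolvesModelSystem

variable {q F lam s κ μ : ℝ} {f₁ f₂ f₃ a c : ℝ → ℝ}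

/-- Energy estimate from `τ = 1` back to `τ = s⁻¹`, where `s = √(1 + lam ^ 2)`. -/
theorem oscillatory_bound (hq : 1 ≤ q) (hs : 1 ≤ s) (hs2 : s ^ 2 = 1 + lam ^ 2)
    (hκ : 1 ≤ κ) (hκs : κ ≤ s ^ 2) (h₁ : ∀ τ ≥ (0 : ℝ), |f₁ τ| ≤ F)
    (h₂ : ∀ τ ≥ (0 : ℝ), |f₂ τ| ≤ F) (h₃ : ∀ τ ≥ (0 : ℝ), |f₃ τ| ≤ F)
    (hsol : SolvesModelSystem q f₁ f₂ f₃ lam a c (Ioi 0)) :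
    s⁻¹ * (deriv a s⁻¹ ^ 2 + s ^ 2 * a s⁻¹ ^ 2) + κ * c s⁻¹ ^ 2
      ≤ 16 * q * Real.exp (37 + 12 * F) *
        (deriv a 1 ^ 2 + s ^ 2 * a 1 ^ 2 + κ * c 1 ^ 2) := by
  have hs0 : 0 < s := by linarith
  have hF : 0 ≤ F := (abs_nonneg _).trans (h₁ 0 le_rfl)
  have hsi1 : s⁻¹ ≤ 1 := inv_le_one_of_one_le₀ hs
  have hsi0 : 0 < s⁻¹ := inv_pos.2 hs0
  have hsi : s⁻¹ * s = 1 := inv_mul_cancel₀ hs0.ne'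
  let w : ℝ → ℝ := fun t => 4 * q + 4 * lam ^ 2 * ((t ^ 2 + 1) ^ 2)⁻¹
  let W : ℝ → ℝ := fun t => t * (deriv a t ^ 2 + w t * a t ^ 2) + a t * deriv a t + κ * c t ^ 2
  let R : ℝ → ℝ := fun t => f₁ t * t * deriv a t + f₂ t * t ^ 2 * a t + f₃ t * c t
  have hgron := backward_gronwall (u := s⁻¹) (v := 1) hsi1 (V := W)
    (V' := fun t => -(a t * deriv a t) / t
        + t * (-(16 * lam ^ 2 * t * ((t ^ 2 + 1) ^ 3)⁻¹)) * a t ^ 2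
        + (2 * t * deriv a t + a t) * R t + 4 * κ * t * a t * c t)
    (G := fun t => (36 + 12 * F) * t - s⁻¹ * t⁻¹)
    (G' := fun t => 36 + 12 * F + (s * t ^ 2)⁻¹) ?_ ?_ ?_
  · have hW1 : W 1 ≤ 8 * q * (deriv a 1 ^ 2 + s ^ 2 * a 1 ^ 2 + κ * c 1 ^ 2) := by
      obtain ⟨hw', hw, -⟩ := potential_bounds hq hs2 one_pos le_rfl
      have e1 := abs_mul_le_half_energy (x := a 1) (y := deriv a 1) one_pos (by linarith) hw'
      have e2 := le_abs_self (a 1 * deriv a 1)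
      have e3 := mul_le_mul_of_nonneg_right hw (sq_nonneg (a 1))
      have e4 : 0 ≤ s ^ 2 * a 1 ^ 2 := by positivity
      have e5 : 0 ≤ κ * c 1 ^ 2 := by positivity
      have e6 := mul_le_mul_of_nonneg_right hq (sq_nonneg (deriv a 1))
      have e7 := mul_le_mul_of_nonneg_right hq e5
      have e8 := mul_le_mul_of_nonneg_right hq e4
      have e9 := sq_nonneg (deriv a 1)
      simp only [W, w]
      linarith
    have hWs : s⁻¹ * (deriv a s⁻¹ ^ 2 + s ^ 2 * a s⁻¹ ^ 2) + κ * c s⁻¹ ^ 2 ≤ 2 * W s⁻¹ := by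
      obtain ⟨hw', -, -⟩ := potential_bounds hq hs2 hsi0 hsi1
      have e1 := abs_mul_le_half_energy (x := a s⁻¹) (y := deriv a s⁻¹) hsi0 hsi.ge hw'
      have e2 := neg_abs_le (a s⁻¹ * deriv a s⁻¹)
      have e3 := mul_le_mul_of_nonneg_left
        (mul_le_mul_of_nonneg_right hw' (sq_nonneg (a s⁻¹))) hsi0.le
      have e5 : 0 ≤ κ * c s⁻¹ ^ 2 := by positivity
      simp only [W, w]
      linarith
    have hW0 : 0 ≤ W s⁻¹ := by
      have : 0 ≤ s⁻¹ * (deriv a s⁻¹ ^ 2 + s ^ 2 * a s⁻¹ ^ 2) + κ * c s⁻¹ ^ 2 := by positivity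
      linarith
    have hB0 : 0 ≤ 8 * q * (deriv a 1 ^ 2 + s ^ 2 * a 1 ^ 2 + κ * c 1 ^ 2) := by positivity
    have k1 : Real.exp (-1) ≤ Real.exp ((36 + 12 * F) * s⁻¹ - s⁻¹ * s⁻¹⁻¹) := by
      apply Real.exp_le_exp.2
      rw [inv_inv, hsi]
      have : 0 ≤ (36 + 12 * F) * s⁻¹ := by positivity
      linarith
    have k2 : Real.exp ((36 + 12 * F) * 1 - s⁻¹ * 1⁻¹) ≤ Real.exp (36 + 12 * F) := by
      apply Real.exp_le_exp.2
      simp only [inv_one, mul_one]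
      linarith
    have k3 : W s⁻¹ * Real.exp (-1) ≤
        8 * q * (deriv a 1 ^ 2 + s ^ 2 * a 1 ^ 2 + κ * c 1 ^ 2) * Real.exp (36 + 12 * F) :=
      (mul_le_mul_of_nonneg_left k1 hW0).trans
        (hgron.trans (mul_le_mul hW1 k2 (Real.exp_pos _).le hB0))
    have k4 := mul_le_mul_of_nonneg_right k3 (Real.exp_pos 1).le
    rw [mul_assoc, ← Real.exp_add, mul_assoc _ (Real.exp (36 + 12 * F)), ← Real.exp_add,
      neg_add_cancel, Real.exp_zero, mul_one,
      (by ring : 36 + 12 * F + 1 = 37 + 12 * F)] at k4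
    linarith
  · intro t ht
    have ht0 : 0 < t := hsi0.trans_le ht.1
    obtain ⟨da, dda, dc, hE, hC⟩ := hsol t ht0
    have hw := hasDerivAt_potential q lam t
    have ha := da.hasDerivAt
    have ha' := dda.hasDerivAt
    have hc := dc.hasDerivAt
    have hd := (((hasDerivAt_id t).fun_mul
      ((ha'.fun_pow 2).fun_add (hw.fun_mul (ha.fun_pow 2)))).fun_add (ha.fun_mul ha')).fun_add ((hc.fun_pow 2).const_mul κ)
    refine hd.congr_deriv ?_
    have hE' : deriv (deriv a) t = R t - t⁻¹ * deriv a t - w t * a t := by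
      simp only [R, w]; linarith
    rw [hE', hC]
    simp only [id, w]
    generalize 16 * lam ^ 2 * t * ((t ^ 2 + 1) ^ 3)⁻¹ = z₁
    generalize ((t ^ 2 + 1) ^ 2)⁻¹ = z₂
    generalize R t = z₃
    field_simp
    ring
  · intro t ht
    have ht0 : 0 < t := hsi0.trans_le ht.1
    have := ((hasDerivAt_id t).const_mul (36 + 12 * F)).fun_sub
      ((hasDerivAt_inv ht0.ne').const_mul s⁻¹)
    refine this.congr_deriv ?_
    field_simp
    ring
  · intro t ht
    have ht0 : 0 < t := hsi0.trans_le ht.1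
    obtain ⟨hw, -, hw'⟩ := potential_bounds hq hs2 ht0 ht.2
    exact oscillatory_energy_inequality hs hκ hκs ht0 ht.2
      (hsi ▸ mul_le_mul_of_nonneg_right ht.1 hs0.le) hw hw' (h₁ t ht0.le) (h₂ t ht0.le)
      (h₃ t ht0.le)

/-- Estimate of the renormalized unknowns from `τ = s⁻¹` back to any smaller time. -/
theorem renormalized_bound (hq : 1 ≤ q) (hs : 1 ≤ s) (hs2 : s ^ 2 = 1 + lam ^ 2)
    (hμ : 1 ≤ μ * s) (hμs : μ ≤ s) (h₁ : ∀ τ ≥ (0 : ℝ), |f₁ τ| ≤ F)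
    (h₂ : ∀ τ ≥ (0 : ℝ), |f₂ τ| ≤ F) (h₃ : ∀ τ ≥ (0 : ℝ), |f₃ τ| ≤ F)
    (hsol : SolvesModelSystem q f₁ f₂ f₃ lam a c (Ioi 0)) {τ : ℝ} (hτ : 0 < τ) (hτs : τ ≤ s⁻¹) :
    (τ * deriv a τ) ^ 2 + (a τ - τ * deriv a τ * Real.log (τ * s)) ^ 2 + μ * c τ ^ 2
      ≤ Real.exp (5 * (8 * q + 6 * F + 4)) *
        ((s⁻¹ * deriv a s⁻¹) ^ 2 + a s⁻¹ ^ 2 + μ * c s⁻¹ ^ 2) := by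
  have hs0 : 0 < s := by linarith
  have hF : 0 ≤ F := (abs_nonneg _).trans (h₁ 0 le_rfl)
  have hsi1 : s⁻¹ ≤ 1 := inv_le_one_of_one_le₀ hs
  have hsi : s⁻¹ * s = 1 := inv_mul_cancel₀ hs0.ne'
  have hμ0 : 0 ≤ μ := by
    by_contra! h
    nlinarith
  let Y : ℝ → ℝ := fun t =>
    (t * deriv a t) ^ 2 + (a t - t * deriv a t * Real.log (t * s)) ^ 2 + μ * c t ^ 2
  let w : ℝ → ℝ := fun t => 4 * q + 4 * lam ^ 2 * ((t ^ 2 + 1) ^ 2)⁻¹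
  let R : ℝ → ℝ := fun t => f₁ t * t * deriv a t + f₂ t * t ^ 2 * a t + f₃ t * c t
  have hgron := backward_gronwall hτs (V := Y)
    (V' := fun t => 2 * (t * deriv a t
        - (a t - t * deriv a t * Real.log (t * s)) * Real.log (t * s)) *
          (t * (-w t * a t + R t)) + 4 * μ * t * a t * c t)
    (G := fun t => 5 * (8 * q + 6 * F + 4) * s * t)
    (G' := fun _ => 5 * (8 * q + 6 * F + 4) * s) ?_ ?_ ?_
  · have hY0 : 0 ≤ Y τ := by positivity
    have hexp : 1 ≤ Real.exp (5 * (8 * q + 6 * F + 4) * s * τ) :=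
      Real.one_le_exp (by positivity)
    have hYs : Y s⁻¹ = (s⁻¹ * deriv a s⁻¹) ^ 2 + a s⁻¹ ^ 2 + μ * c s⁻¹ ^ 2 := by
      simp [Y, hsi]
    have h := (le_mul_of_one_le_right hY0 hexp).trans hgron
    rwa [hYs, mul_assoc _ s, mul_inv_cancel₀ hs0.ne', mul_one, mul_comm] at h
  · intro t ht
    have ht0 : 0 < t := hτ.trans_le ht.1
    obtain ⟨da, dda, dc, hE, hC⟩ := hsol t ht0
    have ha := da.hasDerivAt
    have hp := (hasDerivAt_id t).fun_mul dda.hasDerivAt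
    have hl : HasDerivAt (fun t => Real.log (t * s)) t⁻¹ t := by
      refine (((hasDerivAt_id t).mul_const s).log (by simp [ht0.ne', hs0.ne'])).congr_deriv ?_
      simp only [id]
      field_simp
    have hd := ((hp.fun_pow 2).fun_add ((ha.fun_sub (hp.fun_mul hl)).fun_pow 2)).fun_add
      ((dc.hasDerivAt.fun_pow 2).const_mul μ)
    refine hd.congr_deriv ?_
    have hE' : deriv (deriv a) t = R t - t⁻¹ * deriv a t - w t * a t := by
      simp only [R, w]; linarith
    rw [hE', hC]
    simp only [id]
    generalize w t = z₂
    generalize R t = z₃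
    generalize Real.log (t * s) = z₄
    field_simp
    ring
  · intro t _
    simpa using (hasDerivAt_id t).const_mul (5 * (8 * q + 6 * F + 4) * s)
  · intro t ht
    have ht0 : 0 < t := hτ.trans_le ht.1
    have ht1 : t ≤ 1 := ht.2.trans hsi1
    obtain ⟨hw, hw', -⟩ := potential_bounds hq hs2 ht0 ht1
    exact renormalized_inequality hs (by linarith) hμ hμs ht0 ht1
      (mul_one_add_log_sq_le (by positivity) (hsi ▸ mul_le_mul_of_nonneg_right ht.2 hs0.le))
      ((sq_nonneg s).trans hw) hw' (h₁ t ht0.le) (h₂ t ht0.le) (h₃ t ht0.le)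

end SolvesModelSystem

theorem tendsto_sq_mul_one_add_log_sq_mul_log :
    Tendsto (fun τ : ℝ => τ ^ 2 * (1 + Real.log τ ^ 2)) (nhdsWithin 0 (Ioi 0)) (nhds 0) ∧
    ∀ s : ℝ, 0 < s → Tendsto (fun τ : ℝ => τ ^ 2 * (1 + Real.log τ ^ 2) * Real.log (τ * s))
      (nhdsWithin 0 (Ioi 0)) (nhds 0) := by
  have h0 : Tendsto (fun τ : ℝ => τ) (nhdsWithin 0 (Ioi 0)) (nhds 0) :=
    tendsto_nhdsWithin_of_tendsto_nhds tendsto_id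
  have hlog : Tendsto (fun τ : ℝ => Real.log τ * τ ^ (1 / 2 : ℝ)) (nhdsWithin 0 (Ioi 0))
      (nhds 0) := tendsto_log_mul_rpow_nhdsGT_zero (by norm_num)
  have hsqrt : Tendsto (fun τ : ℝ => √τ) (nhdsWithin 0 (Ioi 0)) (nhds 0) := by
    simpa only [Real.sqrt_zero] using h0.sqrt
  have hl : Tendsto (fun τ : ℝ => √τ * Real.log τ) (nhdsWithin 0 (Ioi 0)) (nhds 0) := by
    refine hlog.congr fun τ => ?_
    rw [Real.sqrt_eq_rpow, mul_comm]
  have hsq : ∀ᶠ τ : ℝ in nhdsWithin 0 (Ioi 0), 0 < τ := eventually_mem_nhdsWithin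
  constructor
  · have := (h0.pow 2).add (h0.mul (hl.pow 2))
    simp only [ne_eq, OfNat.ofNat_ne_zero, not_false_eq_true, zero_pow, mul_zero, add_zero] at this
    refine this.congr' ?_
    filter_upwards [hsq] with τ hτ
    rw [mul_pow, Real.sq_sqrt hτ.le]
    ring
  · intro s hs
    have := ((h0.pow 2).add (h0.mul (hl.pow 2))).mul_const (Real.log s) |>.add
      (((h0.mul hsqrt).mul hl).add (hsqrt.mul (hl.pow 3)))
    simp only [ne_eq, OfNat.ofNat_ne_zero, not_false_eq_true, zero_pow, mul_zero, add_zero,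
      zero_mul] at this
    refine this.congr' ?_
    filter_upwards [hsq] with τ hτ
    rw [Real.log_mul hτ.ne' hs.ne']
    have h2 := Real.sq_sqrt hτ.le
    generalize √τ = r at h2
    subst h2
    ring

/-- The renormalized unknowns converge to the renormalized asymptotic data. -/
theorem HasAsymptoticData.tendsto_renormalized {a c : ℝ → ℝ} {c₀ O h s : ℝ}
    (hdat : HasAsymptoticData a c c₀ O h) (hs : 0 < s) :
    Tendsto (fun τ => τ * deriv a τ) (nhdsWithin 0 (Ioi 0)) (nhds O) ∧
    Tendsto (fun τ => a τ - τ * deriv a τ * Real.log (τ * s)) (nhdsWithin 0 (Ioi 0))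
      (nhds (h - O * Real.log s)) ∧
    Tendsto c (nhdsWithin 0 (Ioi 0)) (nhds c₀) := by
  obtain ⟨hc, rfl, K, hK, hb⟩ := hdat
  obtain ⟨hT, hTl⟩ := tendsto_sq_mul_one_add_log_sq_mul_log
  have hmem : ∀ᶠ τ : ℝ in nhdsWithin 0 (Ioi 0), τ ∈ Ioc (0 : ℝ) 1 :=
    Ioc_mem_nhdsGT one_pos
  have hpb : ∀ τ ∈ Ioc (0 : ℝ) 1, |τ * deriv a τ - O| ≤ K * (τ ^ 2 * (1 + Real.log τ ^ 2)) := by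
    intro τ hτ
    have h1 : τ * deriv a τ - O = τ * (deriv a τ - O / τ) := by
      have := hτ.1.ne'
      field_simp
    rw [h1, abs_mul, abs_of_pos hτ.1]
    have := mul_le_mul_of_nonneg_left (hb τ hτ).2 hτ.1.le
    linarith
  have hKT := hT.const_mul K
  have hKTl := (hTl s hs).abs.const_mul K
  simp only [mul_zero, abs_zero] at hKT hKTl
  refine ⟨?_, ?_, (hc 0 self_mem_Ici).tendsto.mono_left (nhdsWithin_mono _ Ioi_subset_Ici_self)⟩
  · rw [← tendsto_sub_nhds_zero_iff]
    exact squeeze_zero_norm' (hmem.mono hpb) hKT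
  · rw [← tendsto_sub_nhds_zero_iff]
    have hsum := hKT.add hKTl
    rw [add_zero] at hsum
    refine squeeze_zero_norm' ?_ hsum
    filter_upwards [hmem] with τ hτ
    have e : a τ - τ * deriv a τ * Real.log (τ * s) - (h - O * Real.log s)
        = (a τ - O * Real.log τ - h) - (τ * deriv a τ - O) * Real.log (τ * s) := by
      rw [Real.log_mul hτ.1.ne' hs.ne']; ring
    rw [e, Real.norm_eq_abs]
    refine (abs_sub _ _).trans (add_le_add ?_ ?_)
    · have := (hb τ hτ).1
      rwa [mul_assoc] at this
    · rw [abs_mul, abs_mul, abs_of_nonneg (by positivity : 0 ≤ τ ^ 2 * (1 + Real.log τ ^ 2)),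
        ← mul_assoc]
      exact mul_le_mul_of_nonneg_right (hpb τ hτ) (abs_nonneg _)

/-- Backward estimate with a free weight `κ` on the component `c`. -/
theorem weighted_backward_estimate {q F lam s κ : ℝ} {f₁ f₂ f₃ a c : ℝ → ℝ} {c₀ O h : ℝ}
    (hq : 1 ≤ q) (hs : 1 ≤ s) (hs2 : s ^ 2 = 1 + lam ^ 2)
    (hκ : 1 ≤ κ) (hκs : κ ≤ s ^ 2) (h₁ : ∀ τ ≥ (0 : ℝ), |f₁ τ| ≤ F)
    (h₂ : ∀ τ ≥ (0 : ℝ), |f₂ τ| ≤ F) (h₃ : ∀ τ ≥ (0 : ℝ), |f₃ τ| ≤ F)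
    (hsol : SolvesModelSystem q f₁ f₂ f₃ lam a c (Ioi 0)) (hdat : HasAsymptoticData a c c₀ O h) :
    O ^ 2 + (h - O * Real.log s) ^ 2 + κ * s⁻¹ * c₀ ^ 2
      ≤ Real.exp (5 * (8 * q + 6 * F + 4)) * (16 * q * Real.exp (37 + 12 * F)) *
        (s * a 1 ^ 2 + s⁻¹ * deriv a 1 ^ 2 + κ * s⁻¹ * c 1 ^ 2) := by
  have hs0 : 0 < s := by linarith
  have hsi0 : 0 < s⁻¹ := inv_pos.2 hs0
  have hsi : s⁻¹ * s = 1 := inv_mul_cancel₀ hs0.ne'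
  have hμ : 1 ≤ κ * s⁻¹ * s := by rwa [mul_assoc, hsi, mul_one]
  have hμs : κ * s⁻¹ ≤ s := by
    rw [← div_eq_mul_inv, div_le_iff₀ hs0, ← sq]; exact hκs
  obtain ⟨t1, t2, t3⟩ := hdat.tendsto_renormalized hs0
  have hlim := le_of_tendsto (((t1.pow 2).add (t2.pow 2)).add ((t3.pow 2).const_mul (κ * s⁻¹)))
    (by filter_upwards [Ioc_mem_nhdsGT hsi0] with τ hτ using
      hsol.renormalized_bound hq hs hs2 hμ hμs h₁ h₂ h₃ hτ.1 hτ.2)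
  have hosc := mul_le_mul_of_nonneg_left
    (hsol.oscillatory_bound hq hs hs2 hκ hκs h₁ h₂ h₃) hsi0.le
  refine hlim.trans ?_
  rw [mul_assoc (Real.exp _)]
  refine mul_le_mul_of_nonneg_left ?_ (Real.exp_pos _).le
  calc _ = s⁻¹ * (s⁻¹ * (deriv a s⁻¹ ^ 2 + s ^ 2 * a s⁻¹ ^ 2) + κ * c s⁻¹ ^ 2) := by
        field_simp
    _ ≤ _ := hosc
    _ = _ := by
        generalize Real.exp _ = e
        field_simp
        ring

/-- Backward estimate on asymptotic data (single-mode version of Theorem 3.11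
of the paper). -/
theorem backward_estimate_asymptotic_data (q' F : ℝ) (hq : 1 ≤ q') (hF : 0 ≤ F) :
    ∃ C > 0, ∀ f₁ f₂ f₃ : ℝ → ℝ,
      ContinuousOn f₁ (Ici 0) → ContinuousOn f₂ (Ici 0) → ContinuousOn f₃ (Ici 0) →
      (∀ τ ≥ (0:ℝ), |f₁ τ| ≤ F) → (∀ τ ≥ (0:ℝ), |f₂ τ| ≤ F) → (∀ τ ≥ (0:ℝ), |f₃ τ| ≤ F) →
      ∀ lam : ℝ, 0 ≤ lam →
      ∀ a c : ℝ → ℝ, ∀ c₀ O h : ℝ,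
      SolvesModelSystem q' f₁ f₂ f₃ lam a c (Ioi 0) →
      HasAsymptoticData a c c₀ O h →
      ((h - O * Real.log (Real.sqrt (1 + lam ^ 2))) ^ 2 + O ^ 2
          ≤ C * (Real.sqrt (1 + lam ^ 2) * a 1 ^ 2
              + (Real.sqrt (1 + lam ^ 2))⁻¹ * deriv a 1 ^ 2
              + (Real.sqrt (1 + lam ^ 2))⁻¹ * c 1 ^ 2)) ∧
      (Real.sqrt (1 + lam ^ 2) * c₀ ^ 2
          ≤ C * (Real.sqrt (1 + lam ^ 2) * a 1 ^ 2
              + (Real.sqrt (1 + lam ^ 2))⁻¹ * deriv a 1 ^ 2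
              + Real.sqrt (1 + lam ^ 2) * c 1 ^ 2)) := by
  refine ⟨Real.exp (5 * (8 * q' + 6 * F + 4)) * (16 * q' * Real.exp (37 + 12 * F)),
    by positivity, ?_⟩
  intro f₁ f₂ f₃ _ _ _ h₁ h₂ h₃ lam _ a c c₀ O h hsol hdat
  have hs2 : Real.sqrt (1 + lam ^ 2) ^ 2 = 1 + lam ^ 2 := Real.sq_sqrt (by positivity)
  have hs : 1 ≤ Real.sqrt (1 + lam ^ 2) := Real.one_le_sqrt.2 (by nlinarith [sq_nonneg lam])
  generalize Real.sqrt (1 + lam ^ 2) = s at hs hs2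
  have hs0 : 0 < s := by linarith
  have hs1 : 1 ≤ s ^ 2 := one_le_pow₀ hs
  have hss : s ^ 2 * s⁻¹ = s := by field_simp
  constructor
  · have key := weighted_backward_estimate hq hs hs2 le_rfl hs1 h₁ h₂ h₃ hsol hdat
    rw [one_mul] at key
    have : 0 ≤ s⁻¹ * c₀ ^ 2 := by positivity
    linarith
  · have key := weighted_backward_estimate hq hs hs2 hs1 le_rfl h₁ h₂ h₃ hsol hdat
    rw [hss] at key
    have := sq_nonneg O
    have := sq_nonneg (h - O * Real.log s)
    linarith
end
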